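/- Let 0 < ε < 1 and suppose the system satisfies condition C_ε. Then det(b₋, b₊) ≠ 0, and there exist real numbers α⁺, α⁻, β⁺, β⁻ such that (b₊ · ℓ₊) r₊(0) = α⁺ b₊ + β⁺ b₋ and (b₋ · ℓ₋) r₋(0) = α⁻ b₋ + β⁻ b₊, with |α⁺| + |β⁺| ≤ ε/(1−ε) and |α⁻| + |β⁻| ≤ ε/(1−ε). -/

import Mathlib

noncomputable section

/-- The state space `ℝ²`, with the Euclidean norm. -/
abbrev E2 : Type := EuclideanSpace ℝ (Fin 2)

/-- Dot product on `ℝ²`. -/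
def dot2 (a b : E2) : ℝ := a 0 * b 0 + a 1 * b 1

/-- Determinant of the `2×2` matrix with columns `a, b`. -/
def det2 (a b : E2) : ℝ := a 0 * b 1 - a 1 * b 0

/-- Differentiating the eigenvector relation along the eigenvector field at `0`. -/
theorem eig_deriv_aux (V : Set E2) (f : E2 → E2) (L : E2 → ℝ) (r : E2 → E2)
    (hVopen : IsOpen V) (hV0 : (0 : E2) ∈ V)
    (hf : ContDiffOn ℝ (⊤ : ℕ∞) f V)
    (hL : ContDiffOn ℝ (⊤ : ℕ∞) L V) (hr : ContDiffOn ℝ (⊤ : ℕ∞) r V)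
    (hE : ∀ v ∈ V, fderiv ℝ f v (r v) = L v • r v) :
    iteratedFDeriv ℝ 2 f 0 ![r 0, r 0] + fderiv ℝ f 0 (fderiv ℝ r 0 (r 0))
      = fderiv ℝ L 0 (r 0) • r 0 + L 0 • fderiv ℝ r 0 (r 0) := by
  have hN : V ∈ nhds (0 : E2) := hVopen.mem_nhds hV0
  have hfa : ContDiffAt ℝ 2 f 0 := (hf.contDiffAt hN).of_le (WithTop.coe_le_coe.mpr (le_top : (2 : ℕ∞) ≤ ⊤))
  have hLd : DifferentiableAt ℝ L 0 := (hL.contDiffAt hN).differentiableAt (by simp)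
  have hrd : DifferentiableAt ℝ r 0 := (hr.contDiffAt hN).differentiableAt (by simp)
  have hfd : DifferentiableAt ℝ (fderiv ℝ f) 0 :=
    (hfa.fderiv_right (m := 1) (by norm_num)).differentiableAt (by simp)
  have h1 := hfd.hasFDerivAt.clm_apply hrd.hasFDerivAt
  have h2 := hLd.hasFDerivAt.smul hrd.hasFDerivAt
  have he : (fun v => fderiv ℝ f v (r v)) =ᶠ[nhds 0] (fun v => L v • r v) := by
    filter_upwards [hN] with v hv using hE v hv
  have h3 := (h2.congr_of_eventuallyEq he).unique h1
  have h4 := congrArg (fun T : E2 →L[ℝ] E2 => T (r 0)) h3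
  simp at h4
  rw [iteratedFDeriv_two_apply]
  simp only [Matrix.cons_val_zero, Matrix.cons_val_one]
  rw [add_comm, ← h4, add_comm]

theorem dot2_add (l a b : E2) : dot2 l (a + b) = dot2 l a + dot2 l b := by
  simp [dot2]; ring

theorem dot2_smul (l a : E2) (c : ℝ) : dot2 l (c • a) = c * dot2 l a := by
  simp [dot2]; ring

theorem dot2_symm (a b : E2) : dot2 a b = dot2 b a := by
  simp [dot2]; ring

/-- Two vectors with the same products against an independent pair are equal. -/
theorem ext_aux (l k x y : E2) (h : det2 l k ≠ 0) (h1 : dot2 l x = dot2 l y)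
    (h2 : dot2 k x = dot2 k y) : x = y := by
  unfold det2 at h
  unfold dot2 at h1 h2
  have e0 : x 0 = y 0 := mul_left_cancel₀ h (by linear_combination k 1 * h1 - l 1 * h2)
  have e1 : x 1 = y 1 := mul_left_cancel₀ h (by linear_combination l 0 * h2 - k 0 * h1)
  ext i
  fin_cases i
  · exact e0
  · exact e1

theorem est_aux (ε p m K J D : ℝ) (h1 : ε < 1) (hK : 0 < K) (hJ : 0 < J)
    (hp : |p| ≤ ε * J) (hm : |m| ≤ ε * K) (hD : D = m * p + K * J) (hε : 0 < ε) :
    0 < D ∧ |p * m / D| + |p * K / D| ≤ ε / (1 - ε) := by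
  have hpm : |p * m| ≤ (ε * J) * (ε * K) := by
    rw [abs_mul]; exact mul_le_mul hp hm (abs_nonneg _) (by positivity)
  have hKJ := mul_pos hK hJ
  have hlow : (1 - ε ^ 2) * (K * J) ≤ D := by
    have := neg_abs_le (p * m)
    rw [hD]; linarith
  have hpos : 0 < D := lt_of_lt_of_le (mul_pos (by nlinarith) hKJ) hlow
  refine ⟨hpos, ?_⟩
  rw [abs_div, abs_div, abs_of_pos hpos, ← add_div, div_le_div_iff₀ hpos (by linarith)]
  have h3 : |p * K| ≤ ε * J * K := by
    rw [abs_mul, abs_of_pos hK]; exact mul_le_mul_of_nonneg_right hp hK.le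
  calc (|p * m| + |p * K|) * (1 - ε) ≤ ((ε * J) * (ε * K) + ε * J * K) * (1 - ε) :=
        mul_le_mul_of_nonneg_right (add_le_add hpm h3) (by linarith)
    _ = ε * ((1 - ε ^ 2) * (K * J)) := by ring
    _ ≤ ε * D := mul_le_mul_of_nonneg_left hlow hε.le

/-- structure lemma: for `0 < ε < 1`, if the strictly hyperbolic system
satisfies condition `C_ε`, then with `b± := D²f(0):(r±(0) ⊗ r±(0))` one has
`det(b₋, b₊) ≠ 0`, and there are coefficients `α±, β±` with
`(b± · ℓ±) r±(0) = α± b± + β± b∓` and `|α±| + |β±| ≤ ε/(1-ε)`. -/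
theorem structure_lemma
    (ε : ℝ) (hε0 : 0 < ε) (hε1 : ε < 1)
    (V : Set E2) (f : E2 → E2) (Λm Λp : E2 → ℝ) (rm rp : E2 → E2) (lm lp : E2)
    (hVopen : IsOpen V) (hV0 : (0 : E2) ∈ V)
    (hf : ContDiffOn ℝ (⊤ : ℕ∞) f V)
    (hΛm : ContDiffOn ℝ (⊤ : ℕ∞) Λm V) (hΛp : ContDiffOn ℝ (⊤ : ℕ∞) Λp V)
    (hrm : ContDiffOn ℝ (⊤ : ℕ∞) rm V) (hrp : ContDiffOn ℝ (⊤ : ℕ∞) rp V)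
    (hhyp : ∀ v ∈ V, Λm v < Λp v)
    (hrmU : ∀ v ∈ V, ‖rm v‖ = 1) (hrpU : ∀ v ∈ V, ‖rp v‖ = 1)
    (hrmE : ∀ v ∈ V, fderiv ℝ f v (rm v) = Λm v • rm v)
    (hrpE : ∀ v ∈ V, fderiv ℝ f v (rp v) = Λp v • rp v)
    (hlmE : ∀ w : E2, dot2 lm (fderiv ℝ f 0 w) = Λm 0 * dot2 lm w)
    (hlpE : ∀ w : E2, dot2 lp (fderiv ℝ f 0 w) = Λp 0 * dot2 lp w)
    (hlm1 : dot2 lm (rm 0) = 1) (hlp1 : dot2 lp (rp 0) = 1)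
    -- condition C_ε: κ₋ > 0, κ₊ > 0, and
    -- |(∇Λ⁻·r₋)(0)| ≤ ε κ₊ δΛ / A, |(∇Λ⁺·r₊)(0)| ≤ ε κ₋ δΛ / A
    (hκm : 0 < |det2 (rm 0) (rp 0)| * dot2 (fderiv ℝ rm 0 (rm 0)) lp)
    (hκp : 0 < |det2 (rm 0) (rp 0)| * dot2 (fderiv ℝ rp 0 (rp 0)) lm)
    (hcm : |fderiv ℝ Λm 0 (rm 0)| ≤
      ε * (|det2 (rm 0) (rp 0)| * dot2 (fderiv ℝ rp 0 (rp 0)) lm) * (Λp 0 - Λm 0)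
        / |det2 (rm 0) (rp 0)|)
    (hcp : |fderiv ℝ Λp 0 (rp 0)| ≤
      ε * (|det2 (rm 0) (rp 0)| * dot2 (fderiv ℝ rm 0 (rm 0)) lp) * (Λp 0 - Λm 0)
        / |det2 (rm 0) (rp 0)|) :
    det2 (iteratedFDeriv ℝ 2 f 0 ![rm 0, rm 0]) (iteratedFDeriv ℝ 2 f 0 ![rp 0, rp 0]) ≠ 0 ∧
    ∃ αp βp αm βm : ℝ,
      dot2 (iteratedFDeriv ℝ 2 f 0 ![rp 0, rp 0]) lp • rp 0
          = αp • iteratedFDeriv ℝ 2 f 0 ![rp 0, rp 0]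
            + βp • iteratedFDeriv ℝ 2 f 0 ![rm 0, rm 0] ∧
      dot2 (iteratedFDeriv ℝ 2 f 0 ![rm 0, rm 0]) lm • rm 0
          = αm • iteratedFDeriv ℝ 2 f 0 ![rm 0, rm 0]
            + βm • iteratedFDeriv ℝ 2 f 0 ![rp 0, rp 0] ∧
      |αp| + |βp| ≤ ε / (1 - ε) ∧ |αm| + |βm| ≤ ε / (1 - ε) := by
  have em := eig_deriv_aux V f Λm rm hVopen hV0 hf hΛm hrm hrmE
  have ep := eig_deriv_aux V f Λp rp hVopen hV0 hf hΛp hrp hrpE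
  have hδ : 0 < Λp 0 - Λm 0 := sub_pos.mpr (hhyp 0 hV0)
  have om : dot2 lm (rp 0) = 0 := by
    have h := hlmE (rp 0)
    rw [hrpE 0 hV0, dot2_smul] at h
    exact (mul_eq_zero.mp (show (Λp 0 - Λm 0) * dot2 lm (rp 0) = 0 by linarith)).resolve_left hδ.ne'
  have op : dot2 lp (rm 0) = 0 := by
    have h := hlpE (rm 0)
    rw [hrmE 0 hV0, dot2_smul] at h
    exact (mul_eq_zero.mp (show (Λp 0 - Λm 0) * dot2 lp (rm 0) = 0 by linarith)).resolve_left hδ.ne'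
  have hA : 0 < |det2 (rm 0) (rp 0)| := by
    rcases (abs_nonneg (det2 (rm 0) (rp 0))).lt_or_eq with h | h
    · exact h
    · rw [← h] at hκm; simp at hκm
  have km := pos_of_mul_pos_right hκm hA.le
  have kp := pos_of_mul_pos_right hκp hA.le
  rw [dot2_symm] at km kp
  have hcm' : |fderiv ℝ Λm 0 (rm 0)| ≤ ε * ((Λp 0 - Λm 0) * dot2 lm (fderiv ℝ rp 0 (rp 0))) := by
    refine hcm.trans (le_of_eq ?_)
    rw [dot2_symm lm]; field_simp
  have hcp' : |fderiv ℝ Λp 0 (rp 0)| ≤ ε * ((Λp 0 - Λm 0) * dot2 lp (fderiv ℝ rm 0 (rm 0))) := by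
    refine hcp.trans (le_of_eq ?_)
    rw [dot2_symm lp]; field_simp
  have b1 := congrArg (dot2 lp) ep
  have b2 := congrArg (dot2 lm) ep
  have b3 := congrArg (dot2 lp) em
  have b4 := congrArg (dot2 lm) em
  simp only [dot2_add, dot2_smul, hlmE, hlpE, om, op, hlm1, hlp1] at b1 b2 b3 b4
  have hdet : det2 lp lm ≠ 0 := by
    intro h
    have : det2 lp lm * det2 (rp 0) (rm 0)
        = dot2 lp (rp 0) * dot2 lm (rm 0) - dot2 lp (rm 0) * dot2 lm (rp 0) := by
      unfold det2 dot2; ring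
    rw [h, hlp1, hlm1, op] at this
    norm_num at this
  generalize iteratedFDeriv ℝ 2 f 0 ![rp 0, rp 0] = bp at *
  generalize iteratedFDeriv ℝ 2 f 0 ![rm 0, rm 0] = bm at *
  generalize fderiv ℝ Λm 0 (rm 0) = m at *
  generalize fderiv ℝ Λp 0 (rp 0) = p at *
  obtain ⟨K, hK⟩ : ∃ K, K = (Λp 0 - Λm 0) * dot2 lm (fderiv ℝ rp 0 (rp 0)) := ⟨_, rfl⟩
  obtain ⟨J, hJ⟩ : ∃ J, J = (Λp 0 - Λm 0) * dot2 lp (fderiv ℝ rm 0 (rm 0)) := ⟨_, rfl⟩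
  have Kpos : 0 < K := hK ▸ mul_pos hδ kp
  have Jpos : 0 < J := hJ ▸ mul_pos hδ km
  rw [← hK] at hcm'
  rw [← hJ] at hcp'
  have c1 : dot2 lp bp = p := by linarith
  have c2 : dot2 lm bp = K := by linarith
  have c3 : dot2 lp bm = -J := by linarith
  have c4 : dot2 lm bm = m := by linarith
  obtain ⟨Dpos, E1⟩ := est_aux ε p m K J _ hε1 Kpos Jpos hcp' hcm' rfl hε0
  obtain ⟨-, E2'⟩ := est_aux ε m p J K (m * p + K * J) hε1 Jpos Kpos hcm' hcp' (by ring) hε0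
  generalize hD : m * p + K * J = D at *
  refine ⟨?_, p * m / D, -(p * K / D), m * p / D, m * J / D, ?_, ?_, ?_, E2'⟩
  · intro h
    have : det2 lp lm * det2 bm bp
        = dot2 lp bm * dot2 lm bp - dot2 lm bm * dot2 lp bp := by
      unfold det2 dot2; ring
    rw [h, c1, c2, c3, c4] at this
    linarith
  · rw [dot2_symm bp, c1]
    apply ext_aux lp lm _ _ hdet
    · simp only [dot2_add, dot2_smul, c1, c2, c3, c4, hlp1]
      field_simp
      rw [← hD]; ring
    · simp only [dot2_add, dot2_smul, c1, c2, c3, c4, om]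
      field_simp
      ring
  · rw [dot2_symm bm, c4]
    apply ext_aux lp lm _ _ hdet
    · simp only [dot2_add, dot2_smul, c1, c2, c3, c4, op]
      field_simp
      ring
    · simp only [dot2_add, dot2_smul, c1, c2, c3, c4, hlm1]
      field_simp
      rw [← hD]; ring
  · rw [abs_neg]; exact E1
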